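/- (Lemma 1) Let G be a measurable group acting measurably on a type 𝒳, let μ be a left-invariant measure on G, and let E : G → 𝒳 → ℝ be an energy function such that for each X the map T ↦ Real.exp (−E(T | X)) is measurable and the partition function Z(X) := ∫ exp(−E(T | X)) dμ(T) satisfies 0 < Z(X) < ∞. Define the energy-based model P(T | X) := exp(−E(T | X)) / Z(X). If the energy function is equivariant, i.e. E(T' * T | T' • X) = E(T | X) for all T', T ∈ G and X ∈ 𝒳, then the energy-based model is equivariant: P(T' * T | T' • X) = P(T | X) for all T', T ∈ G and X ∈ 𝒳. -/

import Mathlib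

open MeasureTheory ENNReal

/-- **Lemma 1.** An energy-based model `P(T | X) = exp(−E(T | X)) / Z(X)` built from an
equivariant energy function `E` (with respect to a measurable group `G` acting on `𝒳`,
and a left-invariant measure `μ` on `G`) is itself equivariant:
`P(T' * T | T' • X) = P(T | X)`. -/
theorem ebm_equivariant_of_equivariant_energy
    {G 𝒳 : Type*} [Group G] [MeasurableSpace G] [MeasurableMul₂ G] [MulAction G 𝒳]
    (μ : Measure G) [μ.IsMulLeftInvariant]
    (E : G → 𝒳 → ℝ)
    (hmeas : ∀ X : 𝒳, Measurable fun T : G => Real.exp (-(E T X)))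
    (Z : 𝒳 → ℝ≥0∞)
    (hZ : ∀ X : 𝒳, Z X = ∫⁻ T : G, ENNReal.ofReal (Real.exp (-(E T X))) ∂μ)
    (hZpos : ∀ X : 𝒳, 0 < Z X) (hZfin : ∀ X : 𝒳, Z X < ⊤)
    (P : G → 𝒳 → ℝ)
    (hP : ∀ (T : G) (X : 𝒳), P T X = Real.exp (-(E T X)) / (Z X).toReal)
    (hequiv : ∀ (T' T : G) (X : 𝒳), E (T' * T) (T' • X) = E T X)
    (T' T : G) (X : 𝒳) :
    P (T' * T) (T' • X) = P T X := by
  have hZ_smul : Z (T' • X) = Z X := by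
    rw [hZ, hZ, ← lintegral_mul_left_eq_self _ T']
    simp only [hequiv]
  rw [hP, hP, hequiv, hZ_smul]
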